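/- Let a, b ∈ ℝ³ with a ≠ b, L = ‖b−a‖, τ = (b−a)/L, let Λ = {a + sτ : 0 ≤ s ≤ L}, r(x) = dist(x, Λ), and define G(x) = ∫₀^L 1/(4π ‖x − (a + sτ)‖) ds. Let Ω ⊂ ℝ³ be a bounded measurable set and let f : Ω → ℝ be measurable and bounded. Then for every α > 0 the function u_s = f G belongs to L²_{α−1}(Ω), i.e. ∫_Ω r^{2(α−1)} f(x)² G(x)² dx < ∞. -/

import Mathlib

open MeasureTheory Real

/-- `|x| ^ γ` is integrable on symmetric bounded intervals when `-1 < γ`. -/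
theorem integrableOn_abs_rpow {γ : ℝ} (hγ : -1 < γ) {R : ℝ} (hR : 0 ≤ R) :
    IntegrableOn (fun x : ℝ => |x| ^ γ) (Set.Icc (-R) R) := by
  have h1 : IntegrableOn (fun x : ℝ => |x| ^ γ) (Set.Icc 0 R) := by
    have h := (intervalIntegrable_iff_integrableOn_Icc_of_le hR).1
      (intervalIntegral.intervalIntegrable_rpow' (a := 0) (b := R) hγ)
    exact h.congr_fun (fun x hx => by simp only [abs_of_nonneg hx.1]) measurableSet_Icc
  have h2 : IntegrableOn (fun x : ℝ => |x| ^ γ) (Set.Icc (-R) 0) := by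
    have h := ((Measure.measurePreserving_neg (volume : Measure ℝ)).integrableOn_comp_preimage
      (Homeomorph.neg ℝ).measurableEmbedding).2 h1
    simpa [Function.comp_def] using h
  rw [← Set.Icc_union_Icc_eq_Icc (neg_nonpos.2 hR) hR]
  exact h2.union h1

/-- The product of the `γ`-th powers of two coordinates in an orthonormal frame, cut off to a box,
is integrable when `-1 < γ`. -/
theorem integrable_indicator_coord_rpow {γ : ℝ} (hγ : -1 < γ) {R : ℝ} (hR : 0 ≤ R)
    (e : OrthonormalBasis (Fin 3) ℝ (EuclideanSpace ℝ (Fin 3))) (a : EuclideanSpace ℝ (Fin 3)) :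
    Integrable (fun x => (Set.Icc (-R) R).indicator (fun _ => (1 : ℝ)) (inner ℝ (e 0) (x - a)) *
      (Set.Icc (-R) R).indicator (fun v => |v| ^ γ) (inner ℝ (e 1) (x - a)) *
      (Set.Icc (-R) R).indicator (fun v => |v| ^ γ) (inner ℝ (e 2) (x - a))) := by
  let g : Fin 3 → ℝ → ℝ := ![(Set.Icc (-R) R).indicator (fun _ => (1 : ℝ)),
    (Set.Icc (-R) R).indicator (fun v => |v| ^ γ), (Set.Icc (-R) R).indicator (fun v => |v| ^ γ)]
  have hpow := (integrable_indicator_iff measurableSet_Icc).2 (integrableOn_abs_rpow hγ hR)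
  have hone : Integrable ((Set.Icc (-R) R).indicator (fun _ => (1 : ℝ))) :=
    (integrable_indicator_iff measurableSet_Icc).2 (integrableOn_const (by simp))
  have hg : ∀ i, Integrable (g i) := by
    intro i
    fin_cases i
    · exact hone
    · exact hpow
    · exact hpow
  have hprod : Integrable (fun z : Fin 3 → ℝ => ∏ i, g i (z i)) := Integrable.fintype_prod hg
  have hmp := (PiLp.volume_preserving_ofLp (Fin 3)).comp
    (e.measurePreserving_repr.comp (measurePreserving_sub_right volume a))
  have h := hmp.integrable_comp_of_integrable hprod
  refine h.congr (Filter.Eventually.of_forall fun x => ?_)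
  simp [g, Fin.prod_univ_three, OrthonormalBasis.repr_apply_apply, inner_sub_right]

/-- Almost every point has nonzero coordinates in a given orthonormal frame. -/
theorem ae_inner_sub_ne_zero
    (e : OrthonormalBasis (Fin 3) ℝ (EuclideanSpace ℝ (Fin 3))) (a : EuclideanSpace ℝ (Fin 3))
    (i : Fin 3) : ∀ᵐ x, inner ℝ (e i) (x - a) ≠ 0 := by
  have hmp := (PiLp.volume_preserving_ofLp (Fin 3)).comp
    (e.measurePreserving_repr.comp (measurePreserving_sub_right volume a))
  have h := hmp.quasiMeasurePreserving.ae
    (Measure.ae_eval_ne (μ := fun _ : Fin 3 => (volume : Measure ℝ)) i (0 : ℝ))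
  filter_upwards [h] with x hx
  simpa [OrthonormalBasis.repr_apply_apply, inner_sub_right] using hx

/-- The potential of a segment blows up more slowly than any negative power of the distance. -/
theorem exists_integral_one_div_norm_le {E : Type*} [NormedAddCommGroup E] [InnerProductSpace ℝ E]
    (a τ : E) (hτ : ‖τ‖ = 1) {L : ℝ} (hL : 0 ≤ L) {ε : ℝ} (hε : 0 < ε) (hε1 : ε ≤ 1) :
    ∃ K : ℝ, ∀ (y : E) (d : ℝ), 0 < d → (∀ s ∈ Set.Icc 0 L, d ≤ ‖y - (a + s • τ)‖) →
      ∫ s in (0:ℝ)..L, 1 / (4 * π * ‖y - (a + s • τ)‖) ≤ K * d ^ (-ε) := by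
  set h : ℝ → ℝ := (Set.Icc (-1) 1).indicator (fun v => |v| ^ (ε - 1)) with hh
  have hint : Integrable h := (integrable_indicator_iff measurableSet_Icc).2
    (integrableOn_abs_rpow (by linarith) zero_le_one)
  have hnn : ∀ v, 0 ≤ h v := fun v => Set.indicator_nonneg (fun _ _ => by positivity) v
  have hle : ∀ v, |v| ^ (ε - 1) ≤ h v + 1 := by
    intro v
    by_cases hv : v ∈ Set.Icc (-1 : ℝ) 1
    · simp [hh, hv]
    · have h1 : 1 ≤ |v| := by
        by_contra hc
        exact hv (abs_le.1 (not_le.1 hc).le)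
      have := rpow_le_one_of_one_le_of_nonpos h1 (by linarith : ε - 1 ≤ 0)
      linarith [hnn v]
  refine ⟨(∫ v, h v) + L, fun y d hd hdist => ?_⟩
  set t : ℝ := inner ℝ τ (y - a) with ht
  have hint' : Integrable (fun s => h (s - t)) := hint.comp_sub_right t
  have hi1 : IntegrableOn (fun s => h (s - t) + 1) (Set.Ioc 0 L) :=
    hint'.integrableOn.add (integrableOn_const (by simp))
  have hd' : 0 < d ^ (-ε) := rpow_pos_of_pos hd _
  have key : ∀ s ∈ Set.Ioc 0 L, s ≠ t →
      1 / (4 * π * ‖y - (a + s • τ)‖) ≤ (h (s - t) + 1) * d ^ (-ε) := by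
    intro s hs hst
    have hD := hdist s ⟨hs.1.le, hs.2⟩
    have hst' : |s - t| ≤ ‖y - (a + s • τ)‖ := by
      have h1 : inner ℝ τ (y - (a + s • τ)) = t - s := by
        rw [← sub_sub, inner_sub_right, inner_smul_right, real_inner_self_eq_norm_sq, hτ, ← ht]
        ring
      have h2 := abs_real_inner_le_norm τ (y - (a + s • τ))
      rwa [h1, hτ, one_mul, abs_sub_comm] at h2
    set D := ‖y - (a + s • τ)‖
    have hDpos : 0 < D := hd.trans_le hD
    have hpos : 0 < |s - t| := abs_pos.2 (sub_ne_zero.2 hst)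
    calc 1 / (4 * π * D) ≤ 1 / D := by
          apply one_div_le_one_div_of_le hDpos
          nlinarith [pi_gt_three]
      _ = D ^ (ε - 1) * D ^ (-ε) := by
          rw [← rpow_add hDpos, show ε - 1 + -ε = -1 by ring, rpow_neg_one, one_div]
      _ ≤ |s - t| ^ (ε - 1) * d ^ (-ε) :=
          mul_le_mul (rpow_le_rpow_of_nonpos hpos hst' (by linarith))
            (rpow_le_rpow_of_nonpos hd hD (by linarith)) (by positivity) (by positivity)
      _ ≤ _ := by gcongr; exact hle _
  rw [intervalIntegral.integral_of_le hL]
  calc ∫ s in Set.Ioc 0 L, 1 / (4 * π * ‖y - (a + s • τ)‖)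
      ≤ ∫ s in Set.Ioc 0 L, (h (s - t) + 1) * d ^ (-ε) := by
        refine integral_mono_of_nonneg (Filter.Eventually.of_forall fun s => by positivity)
          (hi1.mul_const _) ?_
        filter_upwards [ae_restrict_mem measurableSet_Ioc,
          ae_restrict_of_ae (Measure.ae_ne volume t)] with s hs hst
        exact key s hs hst
    _ = ((∫ s in Set.Ioc 0 L, h (s - t)) + L) * d ^ (-ε) := by
        rw [integral_mul_const, integral_add hint'.integrableOn (integrableOn_const (by simp))]
        simp [hL]
    _ ≤ _ := by
        gcongr
        rw [← integral_sub_right_eq_self h t]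
        exact setIntegral_le_integral hint' (Filter.Eventually.of_forall fun s => hnn _)

theorem singular_part_in_weighted_L2
    (a b : EuclideanSpace ℝ (Fin 3)) (hab : a ≠ b)
    (L : ℝ) (hL : L = ‖b - a‖)
    (τ : EuclideanSpace ℝ (Fin 3)) (hτ : τ = L⁻¹ • (b - a))
    (r : EuclideanSpace ℝ (Fin 3) → ℝ) (hr : ∀ x, r x = Metric.infDist x (segment ℝ a b))
    (G : EuclideanSpace ℝ (Fin 3) → ℝ)
    (hG : ∀ y, G y = ∫ s in (0:ℝ)..L, 1 / (4 * Real.pi * ‖y - (a + s • τ)‖))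
    (Ω : Set (EuclideanSpace ℝ (Fin 3))) (hΩmeas : MeasurableSet Ω)
    (hΩbdd : Bornology.IsBounded Ω)
    (f : EuclideanSpace ℝ (Fin 3) → ℝ) (hf : Measurable f)
    (C : ℝ) (hfC : ∀ x ∈ Ω, |f x| ≤ C)
    (α : ℝ) (hα : 0 < α) :
    IntegrableOn (fun x => r x ^ (2 * (α - 1)) * (f x * G x) ^ 2) Ω := by
  have hLpos : 0 < L := by rw [hL]; exact norm_pos_iff.2 (sub_ne_zero.2 hab.symm)
  have hτ1 : ‖τ‖ = 1 := by
    rw [hτ, norm_smul, norm_inv, norm_of_nonneg hLpos.le, ← hL, inv_mul_cancel₀ hLpos.ne']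
  have hba : b - a = L • τ := by rw [hτ, smul_inv_smul₀ hLpos.ne']
  have hane : (segment ℝ a b).Nonempty := ⟨a, left_mem_segment ℝ a b⟩
  have hseg : ∀ s ∈ Set.Icc 0 L, a + s • τ ∈ segment ℝ a b := by
    intro s hs
    rw [segment_eq_image']
    refine ⟨s / L, ⟨div_nonneg hs.1 hLpos.le, (div_le_one hLpos).2 hs.2⟩, ?_⟩
    simp only [hba, smul_smul, div_mul_cancel₀ _ hLpos.ne']
  obtain ⟨e, he⟩ := Orthonormal.exists_orthonormalBasis_extension_of_card_eq (𝕜 := ℝ)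
    (E := EuclideanSpace ℝ (Fin 3)) (ι := Fin 3) (by simp) (v := fun _ => τ) (s := {0})
    ⟨fun _ => hτ1, fun i j hij => (hij (Subsingleton.elim i j)).elim⟩
  have he0 : e 0 = τ := he 0 rfl
  have hcoord : ∀ i, i ≠ 0 → ∀ x, |inner ℝ (e i) (x - a)| ≤ r x := by
    intro i hi x
    rw [hr, Metric.le_infDist hane]
    intro p hp
    rw [segment_eq_image'] at hp
    obtain ⟨θ, -, rfl⟩ := hp
    have hort : inner ℝ (e i) τ = 0 := by rw [← he0]; exact e.orthonormal.2 hi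
    have h1 : inner ℝ (e i) (x - (a + θ • (b - a))) = inner ℝ (e i) (x - a) := by
      rw [hba, ← sub_sub, inner_sub_right, inner_smul_right, inner_smul_right, hort]
      simp
    rw [← h1, dist_eq_norm]
    simpa using abs_real_inner_le_norm (e i) (x - (a + θ • (b - a)))
  obtain ⟨R, hRpos, hR⟩ := hΩbdd.subset_closedBall_lt 0 a
  have hxR : ∀ x ∈ Ω, ‖x - a‖ ≤ R := fun x hx => by
    simpa [dist_eq_norm] using hR hx
  have hrR : ∀ x ∈ Ω, r x ≤ R := fun x hx => by
    rw [hr]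
    exact (Metric.infDist_le_dist_of_mem (left_mem_segment ℝ a b)).trans
      (by rw [dist_eq_norm]; exact hxR x hx)
  obtain ⟨ε, hε, hε1, hεα⟩ : ∃ ε : ℝ, 0 < ε ∧ ε ≤ 1 ∧ 2 * ε ≤ α :=
    ⟨min (α / 2) 1, by positivity, min_le_right _ _, by linarith [min_le_left (α / 2) 1]⟩
  obtain ⟨K, hK⟩ := exists_integral_one_div_norm_le a τ hτ1 hLpos.le hε hε1
  have hGnn : ∀ x, 0 ≤ G x := fun x => by
    rw [hG]
    exact intervalIntegral.integral_nonneg hLpos.le fun s _ => by positivity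
  have hGle : ∀ x, 0 < r x → G x ≤ K * r x ^ (-ε) := by
    intro x hx
    rw [hG]
    refine hK x (r x) hx fun s hs => ?_
    rw [hr, ← dist_eq_norm]
    exact Metric.infDist_le_dist_of_mem (hseg s hs)
  have hrm : Measurable r := by
    rw [show r = fun x => Metric.infDist x (segment ℝ a b) from funext hr]
    exact (Metric.continuous_infDist_pt _).measurable
  have hGm : Measurable G := by
    have hGeq : G = fun y => ∫ s in Set.Ioc 0 L, 1 / (4 * π * ‖y - (a + s • τ)‖) :=
      funext fun y => by rw [hG, intervalIntegral.integral_of_le hLpos.le]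
    rw [hGeq]
    refine StronglyMeasurable.measurable ?_
    refine StronglyMeasurable.integral_prod_right
      (f := fun (y : EuclideanSpace ℝ (Fin 3)) (s : ℝ) => 1 / (4 * π * ‖y - (a + s • τ)‖)) ?_
    apply Measurable.stronglyMeasurable
    unfold Function.uncurry
    fun_prop
  have hdom := ((integrable_indicator_coord_rpow (γ := ε - 1) (by linarith) hRpos.le e a).const_mul
    (R ^ (2 * (α - 2 * ε)) * (C ^ 2 * K ^ 2))).integrableOn (s := Ω)
  refine hdom.mono' (by fun_prop) ?_
  filter_upwards [ae_restrict_mem hΩmeas, ae_restrict_of_ae (ae_inner_sub_ne_zero e a 1),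
    ae_restrict_of_ae (ae_inner_sub_ne_zero e a 2)] with x hx h1 h2
  have hmem : ∀ i, inner ℝ (e i) (x - a) ∈ Set.Icc (-R) R := fun i => by
    refine abs_le.1 ?_
    have := abs_real_inner_le_norm (e i) (x - a)
    rw [e.orthonormal.1 i, one_mul] at this
    exact this.trans (hxR x hx)
  rw [Set.indicator_of_mem (hmem 0), Set.indicator_of_mem (hmem 1), Set.indicator_of_mem (hmem 2),
    one_mul]
  have hp1 := abs_pos.2 h1
  have hp2 := abs_pos.2 h2
  have hle1 := hcoord 1 (by decide) x
  have hle2 := hcoord 2 (by decide) x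
  have hrpos : 0 < r x := hp1.trans_le hle1
  rw [norm_of_nonneg (by positivity), mul_pow]
  have hf2 : f x ^ 2 ≤ C ^ 2 := sq_le_sq.2 ((hfC x hx).trans (le_abs_self C))
  have hG2 : G x ^ 2 ≤ K ^ 2 * (r x ^ (-ε)) ^ 2 := by
    rw [← mul_pow]
    exact pow_le_pow_left₀ (hGnn x) (hGle x hrpos) 2
  calc r x ^ (2 * (α - 1)) * (f x ^ 2 * G x ^ 2)
      ≤ r x ^ (2 * (α - 1)) * (C ^ 2 * (K ^ 2 * (r x ^ (-ε)) ^ 2)) := by gcongr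
    _ = r x ^ (2 * (α - 2 * ε)) * (C ^ 2 * K ^ 2) * (r x ^ (ε - 1) * r x ^ (ε - 1)) := by
        have hsplit : r x ^ (2 * (α - 1)) * (r x ^ (-ε)) ^ 2 =
            r x ^ (2 * (α - 2 * ε)) * (r x ^ (ε - 1) * r x ^ (ε - 1)) := by
          rw [sq, ← rpow_add hrpos, ← rpow_add hrpos, ← rpow_add hrpos, ← rpow_add hrpos]
          ring_nf
        linear_combination (C ^ 2 * K ^ 2) * hsplit
    _ ≤ R ^ (2 * (α - 2 * ε)) * (C ^ 2 * K ^ 2) *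
        (|inner ℝ (e 1) (x - a)| ^ (ε - 1) * |inner ℝ (e 2) (x - a)| ^ (ε - 1)) := by
        refine mul_le_mul (mul_le_mul_of_nonneg_right (rpow_le_rpow hrpos.le (hrR x hx)
          (by linarith)) (by positivity)) (mul_le_mul ?_ ?_ ?_ ?_) (by positivity) (by positivity)
        · exact rpow_le_rpow_of_nonpos hp1 hle1 (by linarith)
        · exact rpow_le_rpow_of_nonpos hp2 hle2 (by linarith)
        · positivity
        · positivity
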